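/- Fix reals k > 0 and φ, and for q ∈ ℕ set δ_q = 2^{−q−1}·k, Δ = 4k − 2·sin(2(k+φ)) + 2·sin(2φ), a_q = (2k − (sin((2+2^{−q−1})k + 2φ) − sin(2^{−q−1}k + 2φ))/cos(δ_q))/Δ, b_q = (2k·cos(δ_q) − (sin(2(k+φ)) − sin(2φ))/cos(δ_q))/Δ, and d_q = (2k − (sin((2−2^{−q−1})k + 2φ) − sin(2φ − 2^{−q−1}k))/cos(δ_q))/Δ. Then the convergence to 1/2 is exponential in q: there exist a constant C > 0 and a q₀ ∈ ℕ such that for all q ≥ q₀, |a_q − 1/2| ≤ C·2^{−q}, |b_q − 1/2| ≤ C·2^{−q}, and |d_q − 1/2| ≤ C·2^{−q}. -/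

import Mathlib

open Real

/-- The common denominator `Δ = 4k − 2 sin(2(k+φ)) + 2 sin(2φ)`. -/
noncomputable def Δden (k φ : ℝ) : ℝ :=
  4 * k - 2 * Real.sin (2 * (k + φ)) + 2 * Real.sin (2 * φ)

/-- `δ_q = 2^{−q−1}·k`. -/
noncomputable def δq (k : ℝ) (q : ℕ) : ℝ := (2 : ℝ) ^ (-(q : ℤ) - 1) * k

/-- The `(0,0)` entry `a_q` of the reduced density operator `ρ_q^∞`. -/
noncomputable def aq (k φ : ℝ) (q : ℕ) : ℝ :=
  (2 * k - (Real.sin ((2 + (2 : ℝ) ^ (-(q : ℤ) - 1)) * k + 2 * φ) -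
      Real.sin ((2 : ℝ) ^ (-(q : ℤ) - 1) * k + 2 * φ)) / Real.cos (δq k q)) / Δden k φ

/-- The off-diagonal entry `b_q` of the reduced density operator `ρ_q^∞`. -/
noncomputable def bq (k φ : ℝ) (q : ℕ) : ℝ :=
  (2 * k * Real.cos (δq k q) -
      (Real.sin (2 * (k + φ)) - Real.sin (2 * φ)) / Real.cos (δq k q)) / Δden k φ

/-- The `(1,1)` entry `d_q` of the reduced density operator `ρ_q^∞`. -/
noncomputable def dq (k φ : ℝ) (q : ℕ) : ℝ :=
  (2 * k - (Real.sin ((2 - (2 : ℝ) ^ (-(q : ℤ) - 1)) * k + 2 * φ) -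
      Real.sin (2 * φ - (2 : ℝ) ^ (-(q : ℤ) - 1) * k)) / Real.cos (δq k q)) / Δden k φ

theorem rho_aux_Delta (k φ : ℝ) (hk : 0 < k) : 0 < Δden k φ := by
  unfold Δden
  have h : Real.sin (2 * (k + φ)) - Real.sin (2 * φ) = 2 * Real.sin k * Real.cos (k + 2 * φ) := by
    rw [Real.sin_sub_sin]
    congr 2
    · congr 1; ring
    · ring
  have h1 : |Real.sin k| < k := by
    have := Real.abs_sin_lt_abs hk.ne'
    rwa [abs_of_pos hk] at this
  have h2 : Real.sin k * Real.cos (k + 2 * φ) ≤ |Real.sin k| := by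
    refine (le_abs_self _).trans ?_
    rw [abs_mul]
    exact mul_le_of_le_one_right (abs_nonneg _) (Real.abs_cos_le_one _)
  nlinarith

theorem rho_aux_bound (f : ℝ → ℝ) (hf : DifferentiableAt ℝ f 0) (h0 : f 0 = 1 / 2) :
    ∃ C : ℝ, 0 < C ∧ ∀ᶠ q : ℕ in Filter.atTop,
      |f ((2 : ℝ) ^ (-(q : ℤ) - 1)) - 1 / 2| ≤ C * (2 : ℝ) ^ (-(q : ℤ)) := by
  have ht : Filter.Tendsto (fun q : ℕ => (2 : ℝ) ^ (-(q : ℤ) - 1)) Filter.atTop (nhds 0) := by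
    have h := (tendsto_pow_atTop_nhds_zero_of_lt_one (r := (1 / 2 : ℝ))
      (by norm_num) (by norm_num)).mul_const (1 / 2 : ℝ)
    rw [zero_mul] at h
    refine h.congr fun q => ?_
    rw [zpow_sub₀ (by norm_num), zpow_neg, zpow_natCast]
    simp [div_eq_mul_inv]
  obtain ⟨C, hC, hb⟩ := hf.isBigO_sub.exists_pos
  refine ⟨C, hC, ?_⟩
  filter_upwards [ht.eventually hb.bound] with q hq
  rw [h0, sub_zero, Real.norm_eq_abs, Real.norm_eq_abs, abs_of_pos (zpow_pos two_pos _ : (0 : ℝ) < (2 : ℝ) ^ (-(q : ℤ) - 1))] at hq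
  refine hq.trans ?_
  gcongr
  · norm_num
  · linarith

/-- Exponential convergence of the reduced density operator towards `|+⟩⟨+|`:
there are `C > 0` and `q₀` such that for all `q ≥ q₀`,
`|a_q − 1/2| ≤ C·2^{−q}`, `|b_q − 1/2| ≤ C·2^{−q}`, and `|d_q − 1/2| ≤ C·2^{−q}`. -/
theorem rho_exponential_convergence (k φ : ℝ) (hk : 0 < k) :
    ∃ C : ℝ, 0 < C ∧ ∃ q₀ : ℕ, ∀ q : ℕ, q₀ ≤ q →
      |aq k φ q - 1 / 2| ≤ C * (2 : ℝ) ^ (-(q : ℤ)) ∧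
        |bq k φ q - 1 / 2| ≤ C * (2 : ℝ) ^ (-(q : ℤ)) ∧
          |dq k φ q - 1 / 2| ≤ C * (2 : ℝ) ^ (-(q : ℤ)) := by
  have hΔ := (rho_aux_Delta k φ hk).ne'
  have hv : ∀ x : ℝ, x = Δden k φ / 2 → x / Δden k φ = 1 / 2 := by
    intro x hx
    rw [hx]; field_simp
  obtain ⟨C1, h1, e1⟩ := rho_aux_bound
    (fun t => (2 * k - (Real.sin ((2 + t) * k + 2 * φ) -
      Real.sin (t * k + 2 * φ)) / Real.cos (t * k)) / Δden k φ)
    (by fun_prop (disch := simp))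
    (by
      apply hv
      simp only [Δden, zero_mul, Real.cos_zero, add_zero, zero_add, div_one, mul_add]; ring)
  obtain ⟨C2, h2, e2⟩ := rho_aux_bound
    (fun t => (2 * k * Real.cos (t * k) -
      (Real.sin (2 * (k + φ)) - Real.sin (2 * φ)) / Real.cos (t * k)) / Δden k φ)
    (by fun_prop (disch := simp))
    (by
      apply hv
      simp only [Δden, zero_mul, Real.cos_zero, div_one]; ring)
  obtain ⟨C3, h3, e3⟩ := rho_aux_bound
    (fun t => (2 * k - (Real.sin ((2 - t) * k + 2 * φ) -
      Real.sin (2 * φ - t * k)) / Real.cos (t * k)) / Δden k φ)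
    (by fun_prop (disch := simp))
    (by
      apply hv
      simp only [Δden, zero_mul, Real.cos_zero, sub_zero, div_one, mul_add]; ring)
  obtain ⟨q₀, hq⟩ := Filter.eventually_atTop.1 (e1.and (e2.and e3))
  refine ⟨C1 + C2 + C3, by positivity, q₀, fun q hqq => ?_⟩
  obtain ⟨b1, b2, b3⟩ := hq q hqq
  have hp : (0 : ℝ) < (2 : ℝ) ^ (-(q : ℤ)) := by positivity
  refine ⟨b1.trans ?_, b2.trans ?_, b3.trans ?_⟩ <;>
    exact mul_le_mul_of_nonneg_right (by linarith) hp.le
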